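/- Let T_n = (a_{j-k})_{j,k=0}^{n-1} where a_{±m} = C^{±} m^γ (1+o(1)) as m → ∞, with complex C⁺, C⁻, γ satisfying Re γ > -1 and (C⁺,C⁻) ≠ (0,0). Then ‖T_n‖ ~ ‖K‖ · n^{Re γ + 1} as n → ∞, where K is the integral operator on L²(0,1) whose kernel is C⁺(x-y)^γ for x > y and C⁻(y-x)^γ for x < y. -/

import Mathlib

open MeasureTheory Filter Asymptotics Real Set

noncomputable def specNorm {n : ℕ} (M : Matrix (Fin n) (Fin n) ℂ) : ℝ :=
  ‖Matrix.toEuclideanCLM (𝕜 := ℂ) (n := Fin n) M‖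

noncomputable def toeplitz (a : ℤ → ℂ) (n : ℕ) : Matrix (Fin n) (Fin n) ℂ :=
  Matrix.of fun j k => a ((j : ℤ) - (k : ℤ))

noncomputable abbrev μ01 : Measure ℝ := volume.restrict (Set.Ioo 0 1)

noncomputable abbrev L2I := Lp ℂ 2 μ01

def IsIntegralOp (k : ℝ → ℝ → ℂ) (K : L2I →L[ℂ] L2I) : Prop :=
  ∀ f : L2I, ∀ᵐ x ∂μ01, (K f : ℝ → ℂ) x = ∫ y in Set.Ioo (0:ℝ) 1, k x y * (f : ℝ → ℂ) y

noncomputable def fc (a : ℝ → ℂ) (k : ℤ) : ℂ :=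
  (1 / (2 * π)) * ∫ θ in (-π)..π, a θ * Complex.exp (-Complex.I * k * θ)


open scoped ENNReal NNReal

lemma row_bound (H : ℝ → ℝ≥0∞) {x : ℝ} (hx : x ∈ Ioo (0:ℝ) 1) :
    ∫⁻ y, H (x - y) ∂μ01 ≤ ∫⁻ t in Ioo (-1:ℝ) 1, H t := by
  rw [← lintegral_indicator measurableSet_Ioo, ← lintegral_indicator measurableSet_Ioo,
    ← lintegral_sub_left_eq_self (indicator (Ioo (-1:ℝ) 1) H) x]
  refine lintegral_mono fun y => ?_
  by_cases hy : y ∈ Ioo (0:ℝ) 1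
  · have : x - y ∈ Ioo (-1:ℝ) 1 := ⟨by linarith [hx.1, hy.2], by linarith [hx.2, hy.1]⟩
    simp [indicator_of_mem hy, indicator_of_mem this]
  · simp [indicator_of_notMem hy]

lemma col_bound (H : ℝ → ℝ≥0∞) {y : ℝ} (hy : y ∈ Ioo (0:ℝ) 1) :
    ∫⁻ x, H (x - y) ∂μ01 ≤ ∫⁻ t in Ioo (-1:ℝ) 1, H t := by
  rw [← lintegral_indicator measurableSet_Ioo, ← lintegral_indicator measurableSet_Ioo,
    ← lintegral_sub_right_eq_self (indicator (Ioo (-1:ℝ) 1) H) y]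
  refine lintegral_mono fun x => ?_
  by_cases hx : x ∈ Ioo (0:ℝ) 1
  · have : x - y ∈ Ioo (-1:ℝ) 1 := ⟨by linarith [hx.1, hy.2], by linarith [hx.2, hy.1]⟩
    simp [indicator_of_mem hx, indicator_of_mem this]
  · simp [indicator_of_notMem hx]

lemma cs_bound (μ : Measure ℝ) (h F : ℝ → ℝ≥0∞) (hh : Measurable h) (hF : Measurable F) :
    (∫⁻ y, h y * F y ∂μ) ^ 2 ≤ (∫⁻ y, h y ∂μ) * ∫⁻ y, h y * F y ^ 2 ∂μ := by
  have key := ENNReal.lintegral_mul_le_Lp_mul_Lq μ (p := 2) (q := 2)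
    Real.HolderConjugate.two_two
    (f := fun y => h y ^ (1/2:ℝ)) (g := fun y => h y ^ (1/2:ℝ) * F y)
    (by fun_prop) (by fun_prop)
  have e0 : ∀ z : ℝ≥0∞, (z ^ (1/2:ℝ)) ^ (2:ℝ) = z := fun z => by
    rw [← ENNReal.rpow_mul]; norm_num
  have e1 : ∀ z : ℝ≥0∞, z ^ (1/2:ℝ) * z ^ (1/2:ℝ) = z := fun z => by
    rw [← ENNReal.rpow_add_of_nonneg _ _ (by norm_num) (by norm_num)]; norm_num
  have e2 : ∀ y, (h y ^ (1/2:ℝ) * F y) ^ (2:ℝ) = h y * F y ^ 2 := fun y => by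
    rw [ENNReal.mul_rpow_of_nonneg _ _ (by norm_num), e0, ← ENNReal.rpow_natCast]; norm_num
  simp only [Pi.mul_apply, ← mul_assoc, e1, e0, e2] at key
  calc _ ≤ _ := pow_le_pow_left' key 2
    _ = _ := by
      rw [mul_pow, ← ENNReal.rpow_natCast, ← ENNReal.rpow_natCast, ← ENNReal.rpow_mul,
        ← ENNReal.rpow_mul]; norm_num

lemma schur_core (H : ℝ → ℝ≥0∞) (hH : Measurable H) (F : ℝ → ℝ≥0∞) (hF : Measurable F) :
    ∫⁻ x, (∫⁻ y, H (x - y) * F y ∂μ01) ^ 2 ∂μ01 ≤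
      (∫⁻ t in Ioo (-1:ℝ) 1, H t) ^ 2 * ∫⁻ y, F y ^ 2 ∂μ01 := by
  set B := ∫⁻ t in Ioo (-1:ℝ) 1, H t
  calc ∫⁻ x, (∫⁻ y, H (x - y) * F y ∂μ01) ^ 2 ∂μ01
      ≤ ∫⁻ x, B * ∫⁻ y, H (x - y) * F y ^ 2 ∂μ01 ∂μ01 := by
        refine lintegral_mono_ae ?_
        filter_upwards [ae_restrict_mem measurableSet_Ioo] with x hx
        refine (cs_bound _ _ _ (by fun_prop) hF).trans ?_
        gcongr
        exact row_bound H hx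
    _ = B * ∫⁻ x, ∫⁻ y, H (x - y) * F y ^ 2 ∂μ01 ∂μ01 := by
        rw [lintegral_const_mul]
        exact Measurable.lintegral_prod_right' (f := fun p : ℝ × ℝ => H (p.1 - p.2) * F p.2 ^ 2)
          (by fun_prop)
    _ = B * ∫⁻ y, ∫⁻ x, H (x - y) * F y ^ 2 ∂μ01 ∂μ01 := by
        rw [lintegral_lintegral_swap]
        exact Measurable.aemeasurable (by unfold Function.uncurry; fun_prop)
    _ ≤ B * ∫⁻ y, B * F y ^ 2 ∂μ01 := by
        refine mul_le_mul' le_rfl (lintegral_mono_ae ?_)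
        filter_upwards [ae_restrict_mem measurableSet_Ioo] with y hy
        rw [lintegral_mul_const _ (by fun_prop)]
        gcongr
        exact col_bound H hy
    _ = _ := by
        rw [lintegral_const_mul _ (by fun_prop), sq, mul_assoc]

lemma sq_eLpNorm (f : ℝ → ℂ) : eLpNorm f 2 μ01 ^ 2 = ∫⁻ y, ‖f y‖ₑ ^ 2 ∂μ01 := by
  rw [eLpNorm_eq_lintegral_rpow_enorm_toReal (by norm_num) (by norm_num), ← ENNReal.rpow_natCast,
    ← ENNReal.rpow_mul]
  norm_num

lemma schur (H : ℝ → ℝ≥0∞) (hH : Measurable H) (f g : L2I)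
    (hg : ∀ᵐ x ∂μ01, ‖g x‖ₑ ≤ ∫⁻ y, H (x - y) * ‖f y‖ₑ ∂μ01) :
    ‖g‖ₑ ≤ (∫⁻ t in Ioo (-1:ℝ) 1, H t) * ‖f‖ₑ := by
  have hfm : Measurable (fun y => ‖f y‖ₑ) := (Lp.stronglyMeasurable f).measurable.enorm
  rw [Lp.enorm_def, Lp.enorm_def]
  have : eLpNorm g 2 μ01 ^ 2 ≤ ((∫⁻ t in Ioo (-1:ℝ) 1, H t) * eLpNorm f 2 μ01) ^ 2 := by
    rw [mul_pow, sq_eLpNorm, sq_eLpNorm]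
    refine le_trans (lintegral_mono_ae ?_) (schur_core H hH _ hfm)
    filter_upwards [hg] with x hx
    gcongr
  exact (ENNReal.pow_le_pow_left_iff two_ne_zero).1 this

lemma ae_fin (H : ℝ → ℝ≥0∞) (hH : Measurable H) (hfin : ∫⁻ t in Ioo (-1:ℝ) 1, H t ≠ ∞)
    (f : L2I) : ∀ᵐ x ∂μ01, ∫⁻ y, H (x - y) * ‖f y‖ₑ ∂μ01 < ∞ := by
  have hfm : Measurable (fun y => ‖f y‖ₑ) := (Lp.stronglyMeasurable f).measurable.enorm
  have h1 := schur_core H hH _ hfm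
  rw [← sq_eLpNorm, ← mul_pow] at h1
  have h2 : ∫⁻ x, (∫⁻ y, H (x - y) * ‖f y‖ₑ ∂μ01) ^ 2 ∂μ01 ≠ ∞ := by
    refine ne_top_of_le_ne_top ?_ h1
    exact ENNReal.pow_ne_top (ENNReal.mul_ne_top hfin (Lp.eLpNorm_ne_top f))
  have hm : Measurable fun x => (∫⁻ y, H (x - y) * ‖f y‖ₑ ∂μ01) ^ 2 := by
    refine Measurable.pow_const ?_ 2
    exact Measurable.lintegral_prod_right' (f := fun p : ℝ × ℝ => H (p.1 - p.2) * ‖f p.2‖ₑ)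
          (by fun_prop)
  filter_upwards [ae_lt_top hm h2] with x hx
  by_contra h
  simp only [not_lt, top_le_iff] at h
  simp [h] at hx

noncomputable def kerf (Cp Cm γ : ℂ) (t : ℝ) : ℂ :=
  if 0 < t then Cp * ((t : ℝ) : ℂ) ^ γ else if t < 0 then Cm * ((-t : ℝ) : ℂ) ^ γ else 0

lemma measurable_kerf (Cp Cm γ : ℂ) : Measurable (kerf Cp Cm γ) := by
  unfold kerf
  refine Measurable.ite measurableSet_Ioi (by fun_prop) ?_
  exact Measurable.ite measurableSet_Iio (by fun_prop) measurable_const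

lemma norm_kerf_le (Cp Cm γ : ℂ) (t : ℝ) (ht : t ≠ 0) :
    ‖kerf Cp Cm γ t‖ ≤ (‖Cp‖ + ‖Cm‖) * |t| ^ γ.re := by
  unfold kerf
  have hp : 0 ≤ |t| ^ γ.re := by positivity
  rcases lt_or_gt_of_ne ht with h | h
  · rw [if_neg h.not_gt, if_pos h, norm_mul, Complex.norm_cpow_eq_rpow_re_of_pos (by linarith),
      abs_of_neg h] at *
    nlinarith [norm_nonneg Cp, mul_nonneg (norm_nonneg Cp) hp]
  · rw [if_pos h, norm_mul, Complex.norm_cpow_eq_rpow_re_of_pos h, abs_of_pos h] at *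
    nlinarith [norm_nonneg Cm, mul_nonneg (norm_nonneg Cm) hp]

noncomputable def Hn (Cp Cm γ : ℂ) (a : ℤ → ℂ) (n : ℕ) (t : ℝ) : ℝ≥0∞ :=
  ‖(n : ℂ) ^ (-γ) * a ⌊n * t⌋ - kerf Cp Cm γ t‖ₑ +
    ‖(n : ℂ) ^ (-γ) * a (⌊n * t⌋ + 1) - kerf Cp Cm γ t‖ₑ

lemma measurable_Hn (Cp Cm γ : ℂ) (a : ℤ → ℂ) (n : ℕ) : Measurable (Hn Cp Cm γ a n) := by
  have hk := measurable_kerf Cp Cm γ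
  have h1 : Measurable fun t : ℝ => a ⌊n * t⌋ :=
    (measurable_from_top (f := a)).comp (Int.measurable_floor.comp (by fun_prop))
  have h2 : Measurable fun t : ℝ => a (⌊n * t⌋ + 1) :=
    (measurable_from_top (f := fun d => a (d + 1))).comp (Int.measurable_floor.comp (by fun_prop))
  unfold Hn
  fun_prop

lemma diff_le_Hn (Cp Cm γ : ℂ) (a : ℤ → ℂ) (n : ℕ) (x y : ℝ) :
    ‖(n : ℂ) ^ (-γ) * a (⌊n * x⌋ - ⌊n * y⌋) - kerf Cp Cm γ (x - y)‖ₑ ≤ Hn Cp Cm γ a n (x - y) := by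
  have : ⌊n * x⌋ - ⌊n * y⌋ = ⌊n * (x - y)⌋ ∨ ⌊n * x⌋ - ⌊n * y⌋ = ⌊n * (x - y)⌋ + 1 := by
    rw [mul_sub]
    have h1 := Int.floor_le (n * x)
    have h2 := Int.lt_floor_add_one (n * x)
    have h3 := Int.floor_le (n * y)
    have h4 := Int.lt_floor_add_one (n * y)
    have h5 := Int.floor_le (n * x - n * y)
    have h6 := Int.lt_floor_add_one (n * x - n * y)
    have h7 : ⌊n * x - n * y⌋ < ⌊n * x⌋ - ⌊n * y⌋ + 1 := by
      have : (⌊n * x - n * y⌋ : ℝ) < ((⌊n * x⌋ - ⌊n * y⌋ + 1 : ℤ) : ℝ) := by push_cast; linarith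
      exact_mod_cast this
    have h8 : ⌊n * x⌋ - ⌊n * y⌋ < ⌊n * x - n * y⌋ + 2 := by
      have : ((⌊n * x⌋ - ⌊n * y⌋ : ℤ) : ℝ) < ((⌊n * x - n * y⌋ + 2 : ℤ) : ℝ) := by
        push_cast; linarith
      exact_mod_cast this
    omega
  unfold Hn
  rcases this with h | h <;> rw [h]
  · exact le_self_add
  · exact le_add_self

/-- growth bound for the coefficients -/
lemma coeff_bound (Cp Cm γ : ℂ) (a : ℤ → ℂ)
    (εp εm : ℕ → ℂ) (hεp : Tendsto εp atTop (nhds 0)) (hεm : Tendsto εm atTop (nhds 0))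
    (hap : ∀ m : ℕ, 1 ≤ m → a (m : ℤ) = Cp * (m : ℂ) ^ γ * (1 + εp m))
    (ham : ∀ m : ℕ, 1 ≤ m → a (-(m : ℤ)) = Cm * (m : ℂ) ^ γ * (1 + εm m)) :
    ∃ M : ℝ, 0 ≤ M ∧ ∀ d : ℤ, ‖a d‖ ≤ M * (max 1 |(d:ℝ)|) ^ γ.re := by
  obtain ⟨P, hP⟩ := hεp.norm.bddAbove_range
  obtain ⟨Q, hQ⟩ := hεm.norm.bddAbove_range
  replace hP : ∀ m, ‖εp m‖ ≤ P := fun m => hP ⟨m, rfl⟩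
  replace hQ : ∀ m, ‖εm m‖ ≤ Q := fun m => hQ ⟨m, rfl⟩
  have hP0 : 0 ≤ P := (norm_nonneg _).trans (hP 0)
  have hQ0 : 0 ≤ Q := (norm_nonneg _).trans (hQ 0)
  have main : ∀ (C : ℂ) (ε : ℕ → ℂ) (R : ℝ) (hR : ∀ m, ‖ε m‖ ≤ R) (m : ℕ), 1 ≤ m →
      ‖C * (m : ℂ) ^ γ * (1 + ε m)‖ ≤ ‖C‖ * (1 + R) * (max 1 (m:ℝ)) ^ γ.re := by
    intro C ε R hR m hm
    rw [norm_mul, norm_mul, Complex.norm_natCast_cpow_of_pos (by omega),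
      max_eq_right (by exact_mod_cast hm)]
    have : ‖1 + ε m‖ ≤ 1 + R := (norm_add_le _ _).trans (by simpa using hR m)
    calc _ ≤ ‖C‖ * (m:ℝ) ^ γ.re * (1 + R) := by gcongr
      _ = _ := by ring
  refine ⟨‖a 0‖ + ‖Cp‖ * (1 + P) + ‖Cm‖ * (1 + Q), by positivity, fun d => ?_⟩
  have hpos : 0 ≤ (max 1 |(d:ℝ)|) ^ γ.re := by positivity
  rcases lt_trichotomy d 0 with h | h | h
  · obtain ⟨m, rfl⟩ : ∃ m : ℕ, d = -(m:ℤ) := ⟨d.natAbs, by omega⟩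
    rw [ham m (by omega)]
    refine (main Cm εm Q hQ m (by omega)).trans ?_
    have : |((-(m:ℤ) : ℤ) : ℝ)| = m := by simp
    rw [this] at *
    gcongr
    linarith [norm_nonneg (a 0), mul_nonneg (norm_nonneg Cp) (by linarith : 0 ≤ 1 + P)]
  · subst h
    simp only [Int.cast_zero, abs_zero, zero_le_one, sup_of_le_left, one_rpow, mul_one]
    linarith [mul_nonneg (norm_nonneg Cm) (by linarith : 0 ≤ 1 + Q), mul_nonneg (norm_nonneg Cp) (by linarith : 0 ≤ 1 + P)]
  · obtain ⟨m, rfl⟩ : ∃ m : ℕ, d = (m:ℤ) := ⟨d.natAbs, by omega⟩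
    rw [hap m (by omega)]
    refine (main Cp εp P hP m (by omega)).trans ?_
    have : |((m:ℤ) : ℝ)| = m := by simp
    rw [this] at *
    gcongr
    linarith [norm_nonneg (a 0), mul_nonneg (norm_nonneg Cm) (by linarith : 0 ≤ 1 + Q)]

lemma rpow_between {α u v w : ℝ} (hu : 0 < u) (huv : u ≤ v) (hvw : v ≤ w) :
    v ^ α ≤ u ^ α + w ^ α := by
  have := hu.trans_le huv
  have := this.trans_le hvw
  rcases le_total 0 α with h | h
  · have := Real.rpow_le_rpow (by linarith) hvw h
    have : 0 ≤ u ^ α := by positivity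
    linarith
  · have := Real.rpow_le_rpow_of_nonpos hu huv h
    have : 0 ≤ w ^ α := by positivity
    linarith

lemma scaled_bound (γ : ℂ) (a : ℤ → ℂ) (M : ℝ) (hM : 0 ≤ M)
    (ha : ∀ d : ℤ, ‖a d‖ ≤ M * (max 1 |(d:ℝ)|) ^ γ.re) (n : ℕ) (hn : 1 ≤ n) (t : ℝ)
    (ht : t ≠ 0) (ht1 : |t| ≤ 1) (d : ℤ) (hd : |n * t - d| ≤ 1) :
    ‖(n : ℂ) ^ (-γ) * a d‖ ≤ M * ((|t| / 2) ^ γ.re + 2 ^ γ.re) := by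
  have hn' : (1:ℝ) ≤ n := by exact_mod_cast hn
  have hn0 : (0:ℝ) < n := by linarith
  have htp : 0 < |t| := abs_pos.2 ht
  rw [norm_mul, Complex.norm_natCast_cpow_of_pos hn]
  set e := max 1 |(d:ℝ)|
  have he1 : 1 ≤ e := le_max_left _ _
  have hde : |(d:ℝ)| ≤ e := le_max_right _ _
  have habs : |n * t| = n * |t| := by rw [abs_mul, abs_of_pos hn0]
  have h1 : n * |t| ≤ 2 * e := by
    have : |n * t| ≤ |n * t - d| + |(d:ℝ)| := by
      simpa using abs_add_le (n * t - d) (d:ℝ)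
    linarith
  have h2 : e ≤ 2 * n := by
    refine max_le (by linarith) ?_
    have : |(d:ℝ)| ≤ |n * t - d| + |n * t| := by
      have := abs_sub_abs_le_abs_sub (d:ℝ) (n * t)
      rw [abs_sub_comm] at this; linarith
    have : n * |t| ≤ n * 1 := by gcongr
    linarith
  have h3 : (e / n) ^ γ.re ≤ (|t| / 2) ^ γ.re + 2 ^ γ.re := by
    refine rpow_between (by positivity) ?_ ?_
    · rw [div_le_div_iff₀ (by norm_num) hn0]; linarith
    · rw [div_le_iff₀ hn0]; linarith
  calc _ ≤ (n:ℝ) ^ (-γ.re) * (M * e ^ γ.re) := by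
        rw [Complex.neg_re]; gcongr; exact ha d
    _ = M * (e / n) ^ γ.re := by
        rw [Real.div_rpow (by linarith) hn0.le, Real.rpow_neg hn0.le]; ring
    _ ≤ _ := by gcongr

lemma integrableOn_abs_rpow {α : ℝ} (h : -1 < α) :
    IntegrableOn (fun t : ℝ => |t| ^ α) (Ioo (-1:ℝ) 1) := by
  have h0 : IntegrableOn (fun t : ℝ => t ^ α) (Ioo 0 1) :=
    (intervalIntegral.integrableOn_Ioo_rpow_iff one_pos).2 h
  have h1 : IntegrableOn (fun t : ℝ => |t| ^ α) (Ioo 0 1) :=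
    h0.congr_fun (fun t ht => by simp [abs_of_pos ht.1]) measurableSet_Ioo
  have h2 : IntegrableOn (fun t : ℝ => |t| ^ α) (Ioo (-1) 0) := by
    have := h1.comp_neg
    simpa using this
  have h3 : IntegrableOn (fun t : ℝ => |t| ^ α) (Ioc (-1) 0) :=
    h2.congr_set_ae Ioo_ae_eq_Ioc.symm
  have := h3.union h1
  rwa [Ioc_union_Ioo_eq_Ioo (by norm_num) (by norm_num)] at this

lemma kerf_fin (Cp Cm γ : ℂ) (hγ : -1 < γ.re) :
    ∫⁻ t in Ioo (-1:ℝ) 1, ‖kerf Cp Cm γ t‖ₑ ≠ ∞ := by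
  have h := ((integrableOn_abs_rpow hγ).const_mul (‖Cp‖ + ‖Cm‖)).hasFiniteIntegral
  refine ne_top_of_le_ne_top h.ne ?_
  refine lintegral_mono_ae ?_
  have h0 : ∀ᵐ t : ℝ ∂(volume.restrict (Ioo (-1:ℝ) 1)), t ≠ 0 :=
    ae_restrict_of_ae (by simp [ae_iff])
  filter_upwards [h0] with t ht
  rw [enorm_le_iff_norm_le]
  exact (norm_kerf_le _ _ _ _ ht).trans (le_abs_self _)

lemma lim_aux (C γ : ℂ) (ε : ℕ → ℂ) (hε : Tendsto ε atTop (nhds 0)) (t : ℝ) (ht : 0 < t)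
    (m : ℕ → ℕ) (hm : ∀ n, |n * t - m n| ≤ 1) :
    Tendsto (fun n : ℕ => (n : ℂ) ^ (-γ) * (C * (m n : ℂ) ^ γ * (1 + ε (m n)))) atTop
      (nhds (C * (t : ℂ) ^ γ)) := by
  have hq : Tendsto (fun n : ℕ => (m n : ℝ) / n) atTop (nhds t) := by
    rw [tendsto_iff_norm_sub_tendsto_zero]
    refine squeeze_zero' (g := fun n : ℕ => 1 / (n:ℝ)) (Eventually.of_forall fun _ => norm_nonneg _) ?_
      tendsto_one_div_atTop_nhds_zero_nat
    filter_upwards [eventually_ge_atTop 1] with n hn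
    have hn0 : (0:ℝ) < n := by exact_mod_cast hn
    have : (m n : ℝ) / n - t = -(n * t - m n) / n := by field_simp; ring
    rw [this, norm_div, norm_neg, Real.norm_eq_abs, Real.norm_eq_abs, abs_of_pos hn0]
    gcongr
    exact hm n
  have hmt : Tendsto m atTop atTop := by
    rw [← tendsto_natCast_atTop_iff (R := ℝ)]
    have : Tendsto (fun n : ℕ => (n:ℝ) * t - 1) atTop atTop :=
      tendsto_atTop_add_const_right _ _ (tendsto_natCast_atTop_atTop.atTop_mul_const ht)
    refine tendsto_atTop_mono (fun n => ?_) this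
    linarith [(abs_le.1 (hm n)).2]
  have hqc : Tendsto (fun n : ℕ => (((m n : ℝ) / n : ℝ) : ℂ) ^ γ) atTop (nhds ((t:ℂ) ^ γ)) := by
    have : ContinuousAt (fun z : ℂ => z ^ γ) (t:ℂ) :=
      continuousAt_cpow_const (by simp [Complex.mem_slitPlane_iff, ht])
    exact this.tendsto.comp ((Complex.continuous_ofReal.tendsto t).comp hq)
  have h2 := (hqc.const_mul C).mul ((hε.comp hmt).const_add 1)
  simp only [add_zero, mul_one] at h2
  refine h2.congr' ?_
  filter_upwards [eventually_ge_atTop 1] with n hn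
  have hn0 : (0:ℝ) < n := by exact_mod_cast hn
  rw [div_eq_mul_inv, Complex.ofReal_mul, Complex.mul_cpow_ofReal_nonneg (by positivity) (by positivity)]
  have : (((n:ℝ)⁻¹ : ℝ) : ℂ) ^ γ = (n:ℂ) ^ (-γ) := by
    rw [Complex.ofReal_inv, Complex.ofReal_natCast, Complex.inv_cpow _ _ (by
      rw [Complex.natCast_arg]; exact Real.pi_pos.ne), Complex.cpow_neg]
  rw [this]
  simp only [Function.comp, Complex.ofReal_natCast]
  ring

lemma toNat_cast_real (z : ℤ) : ((z.toNat : ℕ) : ℝ) = max (z : ℝ) 0 := by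
  rcases le_total 0 z with h | h
  · have h1 : (0:ℝ) ≤ z := by exact_mod_cast h
    rw [max_eq_left h1]
    exact_mod_cast Int.toNat_of_nonneg h
  · have h1 : (z:ℝ) ≤ 0 := by exact_mod_cast h
    rw [max_eq_right h1, Int.toNat_of_nonpos h]
    simp

lemma lim_coeff (Cp Cm γ : ℂ) (a : ℤ → ℂ)
    (εp εm : ℕ → ℂ) (hεp : Tendsto εp atTop (nhds 0)) (hεm : Tendsto εm atTop (nhds 0))
    (hap : ∀ m : ℕ, 1 ≤ m → a (m : ℤ) = Cp * (m : ℂ) ^ γ * (1 + εp m))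
    (ham : ∀ m : ℕ, 1 ≤ m → a (-(m : ℤ)) = Cm * (m : ℂ) ^ γ * (1 + εm m))
    (t : ℝ) (ht : t ≠ 0) (d : ℕ → ℤ) (hd : ∀ n : ℕ, |n * t - d n| ≤ 1) :
    Tendsto (fun n : ℕ => (n : ℂ) ^ (-γ) * a (d n)) atTop (nhds (kerf Cp Cm γ t)) := by
  have hbig : ∀ s : ℝ, 0 < s → ∀ᶠ n : ℕ in atTop, 2 < (n:ℝ) * s := fun s hs =>
    (tendsto_natCast_atTop_atTop.atTop_mul_const hs).eventually_gt_atTop 2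
  unfold kerf
  rcases lt_or_gt_of_ne ht with h | h
  · rw [if_neg h.not_gt, if_pos h]
    have key := lim_aux Cm γ εm hεm (-t) (by linarith)
      (fun n => (-(d n)).toNat) (fun n => by
        have h1 : (((-(d n)).toNat : ℕ) : ℝ) = max (-(d n) : ℝ) 0 := by
          simpa using toNat_cast_real (-(d n))
        rw [h1]
        have := abs_le.1 (hd n)
        have h3 : 0 ≤ (n:ℝ) * (-t) := mul_nonneg (by positivity) (by linarith)
        rcases max_cases (-(d n) : ℝ) 0 with h | h <;> rw [h.1, abs_le] <;>
          constructor <;> linarith)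
    refine key.congr' ?_
    filter_upwards [hbig (-t) (by linarith)] with n hn
    have h2 : d n < -1 := by
      have : (d n : ℝ) < ((-1 : ℤ) : ℝ) := by push_cast; linarith [(abs_le.1 (hd n)).1]
      exact_mod_cast this
    rw [← ham _ (by omega)]
    congr 2
    omega
  · rw [if_pos h]
    have key := lim_aux Cp γ εp hεp t h
      (fun n => (d n).toNat) (fun n => by
        have h1 : (((d n).toNat : ℕ) : ℝ) = max (d n : ℝ) 0 := by
          exact toNat_cast_real (d n)
        rw [h1]
        have := abs_le.1 (hd n)
        have h3 : 0 ≤ (n:ℝ) * t := mul_nonneg (by positivity) (by linarith)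
        rcases max_cases (d n : ℝ) 0 with h | h <;> rw [h.1, abs_le] <;>
          constructor <;> linarith)
    refine key.congr' ?_
    filter_upwards [hbig t h] with n hn
    have h2 : 1 < d n := by
      have : ((1 : ℤ) : ℝ) < (d n : ℝ) := by push_cast; linarith [(abs_le.1 (hd n)).2]
      exact_mod_cast this
    rw [← hap _ (by omega)]
    congr 2
    omega

lemma Hn_tendsto (Cp Cm γ : ℂ) (hγ : -1 < γ.re) (a : ℤ → ℂ)
    (εp εm : ℕ → ℂ) (hεp : Tendsto εp atTop (nhds 0)) (hεm : Tendsto εm atTop (nhds 0))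
    (hap : ∀ m : ℕ, 1 ≤ m → a (m : ℤ) = Cp * (m : ℂ) ^ γ * (1 + εp m))
    (ham : ∀ m : ℕ, 1 ≤ m → a (-(m : ℤ)) = Cm * (m : ℂ) ^ γ * (1 + εm m)) :
    Tendsto (fun n : ℕ => ∫⁻ t in Ioo (-1:ℝ) 1, Hn Cp Cm γ a n t) atTop (nhds 0) := by
  obtain ⟨M, hM, hMa⟩ := coeff_bound Cp Cm γ a εp εm hεp hεm hap ham
  have h0 : ∀ᵐ t : ℝ ∂(volume.restrict (Ioo (-1:ℝ) 1)), t ≠ 0 :=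
    ae_restrict_of_ae (by simp [ae_iff])
  have hd0 : ∀ (n : ℕ) (t : ℝ), |n * t - (⌊n * t⌋ : ℤ)| ≤ 1 := fun n t => by
    rw [abs_le]; constructor <;> linarith [Int.floor_le (n * t), Int.lt_floor_add_one (n * t)]
  have hd1 : ∀ (n : ℕ) (t : ℝ), |n * t - (⌊n * t⌋ + 1 : ℤ)| ≤ 1 := fun n t => by
    push_cast
    rw [abs_le]; constructor <;> linarith [Int.floor_le (n * t), Int.lt_floor_add_one (n * t)]
  set G : ℝ → ℝ := fun t => 2 * (M * ((1 / 2) ^ γ.re * |t| ^ γ.re + 2 ^ γ.re) +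
    (‖Cp‖ + ‖Cm‖) * |t| ^ γ.re) with hG
  have hGi : IntegrableOn G (Ioo (-1:ℝ) 1) := by
    have h1 := integrableOn_abs_rpow hγ
    have hc : IntegrableOn (fun _ : ℝ => (2:ℝ) ^ γ.re) (Ioo (-1:ℝ) 1) := by
      simp
    exact ((((h1.const_mul ((1 / 2) ^ γ.re)).add hc).const_mul M).add
      (h1.const_mul (‖Cp‖ + ‖Cm‖))).const_mul 2
  have hdct := tendsto_lintegral_filter_of_dominated_convergence
    (μ := volume.restrict (Ioo (-1:ℝ) 1)) (l := atTop)
    (F := fun n t => Hn Cp Cm γ a n t) (f := fun _ => 0) (fun t => ‖G t‖ₑ)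
    (Eventually.of_forall fun n => measurable_Hn Cp Cm γ a n)
    (by
      filter_upwards [eventually_ge_atTop 1] with n hn
      filter_upwards [h0, ae_restrict_mem measurableSet_Ioo] with t ht ht1
      have ht1' : |t| ≤ 1 := abs_le.2 ⟨ht1.1.le, ht1.2.le⟩
      have e : (|t| / 2) ^ γ.re = (1 / 2) ^ γ.re * |t| ^ γ.re := by
        rw [← Real.mul_rpow (by norm_num) (abs_nonneg _)]; congr 1; ring
      have b : ∀ d : ℤ, |n * t - d| ≤ 1 → ‖(n : ℂ) ^ (-γ) * a d - kerf Cp Cm γ t‖ₑ ≤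
          ENNReal.ofReal (G t / 2) := fun d hd => by
        rw [← ofReal_norm]
        refine ENNReal.ofReal_le_ofReal ?_
        refine (norm_sub_le _ _).trans ?_
        have := scaled_bound γ a M hM hMa n hn t ht ht1' d hd
        rw [e] at this
        have := norm_kerf_le Cp Cm γ t ht
        simp only [hG]; linarith
      have hGp : 0 ≤ G t := by simp only [hG]; positivity
      unfold Hn
      refine (add_le_add (b _ (hd0 n t)) (b _ (hd1 n t))).trans ?_
      rw [← ENNReal.ofReal_add (by positivity) (by positivity), add_halves,
        ← ofReal_norm, Real.norm_eq_abs, abs_of_nonneg hGp])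
    hGi.hasFiniteIntegral.ne
    (by
      filter_upwards [h0] with t ht
      have c : ∀ d : ℕ → ℤ, (∀ n : ℕ, |n * t - d n| ≤ 1) →
          Tendsto (fun n : ℕ => ‖(n : ℂ) ^ (-γ) * a (d n) - kerf Cp Cm γ t‖ₑ) atTop (nhds 0) := by
        intro d hd
        have := (lim_coeff Cp Cm γ a εp εm hεp hεm hap ham t ht d hd).sub_const (kerf Cp Cm γ t)
        rw [sub_self] at this
        simpa using this.enorm
      simpa [Hn] using (c _ (fun n => hd0 n t)).add (c _ (fun n => hd1 n t)))
  simpa using hdct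

open scoped InnerProductSpace

noncomputable def synth {n : ℕ} (v : Fin n → L2I) : EuclideanSpace ℂ (Fin n) →L[ℂ] L2I :=
  LinearMap.toContinuousLinearMap
    { toFun := fun w => ∑ j, w j • v j
      map_add' := fun w z => by simp [add_smul, Finset.sum_add_distrib]
      map_smul' := fun c w => by simp [mul_smul, Finset.smul_sum] }

lemma synth_apply {n : ℕ} (v : Fin n → L2I) (w : EuclideanSpace ℂ (Fin n)) :
    synth v w = ∑ j, w j • v j := rfl

lemma synth_adjoint_apply {n : ℕ} (v : Fin n → L2I) (f : L2I) (j : Fin n) :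
    (ContinuousLinearMap.adjoint (synth v) f) j = ⟪v j, f⟫_ℂ := by
  have h : ⟪EuclideanSpace.single j (1:ℂ), ContinuousLinearMap.adjoint (synth v) f⟫_ℂ =
      ⟪v j, f⟫_ℂ := by
    rw [ContinuousLinearMap.adjoint_inner_right]
    congr 1
    rw [synth_apply, Finset.sum_eq_single j]
    · simp
    · intro i _ hi; simp [hi]
    · simp
  rw [← h, EuclideanSpace.inner_single_left]
  simp

lemma synth_adjoint_synth {n : ℕ} (v : Fin n → L2I) (hv : Orthonormal ℂ v)
    (w : EuclideanSpace ℂ (Fin n)) : ContinuousLinearMap.adjoint (synth v) (synth v w) = w := by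
  ext j
  rw [synth_adjoint_apply, synth_apply, hv.inner_right_fintype]

lemma synth_norm {n : ℕ} (v : Fin n → L2I) (hv : Orthonormal ℂ v) : ‖synth v‖ ≤ 1 := by
  refine ContinuousLinearMap.opNorm_le_bound _ zero_le_one fun w => ?_
  rw [one_mul]
  have h : ‖synth v w‖ ^ 2 = ‖w‖ ^ 2 := by
    rw [ContinuousLinearMap.apply_norm_sq_eq_inner_adjoint_left]
    rw [ContinuousLinearMap.comp_apply, synth_adjoint_synth v hv, inner_self_eq_norm_sq]
  exact le_of_eq ((sq_eq_sq₀ (norm_nonneg _) (norm_nonneg _)).1 h)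

lemma norm_conj {n : ℕ} (v : Fin n → L2I) (hv : Orthonormal ℂ v)
    (T : EuclideanSpace ℂ (Fin n) →L[ℂ] EuclideanSpace ℂ (Fin n)) :
    ‖(synth v).comp (T.comp (ContinuousLinearMap.adjoint (synth v)))‖ = ‖T‖ := by
  have h1 := synth_norm v hv
  have h2 : ‖ContinuousLinearMap.adjoint (synth v)‖ ≤ 1 := by
    rwa [LinearIsometryEquiv.norm_map]
  have aux : ∀ {E F G H : Type} [NormedAddCommGroup E] [NormedAddCommGroup F]
      [NormedAddCommGroup G] [NormedAddCommGroup H] [NormedSpace ℂ E] [NormedSpace ℂ F]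
      [NormedSpace ℂ G] [NormedSpace ℂ H] (A : G →L[ℂ] H) (B : F →L[ℂ] G) (C : E →L[ℂ] F),
      ‖A‖ ≤ 1 → ‖C‖ ≤ 1 → ‖A.comp (B.comp C)‖ ≤ ‖B‖ := by
    intro E F G H _ _ _ _ _ _ _ _ A B C hA hC
    calc _ ≤ ‖A‖ * ‖B.comp C‖ := ContinuousLinearMap.opNorm_comp_le _ _
      _ ≤ 1 * (‖B‖ * ‖C‖) := by
        gcongr; exact ContinuousLinearMap.opNorm_comp_le _ _
      _ ≤ 1 * (‖B‖ * 1) := by gcongr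
      _ = _ := by ring
  refine le_antisymm (aux _ _ _ h1 h2) ?_
  set S := (synth v).comp (T.comp (ContinuousLinearMap.adjoint (synth v)))
  have : T = (ContinuousLinearMap.adjoint (synth v)).comp (S.comp (synth v)) := by
    refine ContinuousLinearMap.ext fun w => ?_
    simp only [S, ContinuousLinearMap.comp_apply, synth_adjoint_synth v hv]
  calc ‖T‖ = _ := congrArg norm this
    _ ≤ ‖S‖ := aux _ _ _ h2 h1

def cell (n : ℕ) (j : ℕ) : Set ℝ := {x | ⌊(n:ℝ) * x⌋ = (j:ℤ)}

lemma measurableSet_cell (n j : ℕ) : MeasurableSet (cell n j) :=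
  (Int.measurable_floor.comp (measurable_const_mul (n:ℝ))) (measurableSet_singleton (j:ℤ))

lemma cell_measure (n j : ℕ) (hj : j < n) : μ01.real (cell n j) = 1 / n := by
  have hn : (0:ℝ) < n := by exact_mod_cast (by omega : 0 < n)
  have hj' : (j:ℝ) + 1 ≤ n := by exact_mod_cast hj
  have h1 : μ01 = volume.restrict (Ico (0:ℝ) 1) := Measure.restrict_congr_set Ioo_ae_eq_Ico
  have h2 : cell n j ∩ Ico 0 1 = Ico ((j:ℝ) / n) ((j + 1 : ℝ) / n) := by
    ext x
    simp only [cell, mem_inter_iff, mem_ofPred_eq, mem_Ico, Int.floor_eq_iff, div_le_iff₀ hn,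
      lt_div_iff₀ hn, Int.cast_natCast]
    constructor
    · rintro ⟨⟨h, h'⟩, -⟩; constructor <;> linarith
    · rintro ⟨h, h'⟩
      refine ⟨⟨by linarith, by linarith⟩, ?_, ?_⟩
      · by_contra hx
        have : x * n < 0 := mul_neg_of_neg_of_pos (by linarith) hn
        have : (0:ℝ) ≤ j := by positivity
        linarith
      · by_contra hx
        have : 1 * (n:ℝ) ≤ x * n := by gcongr; linarith
        linarith
  rw [measureReal_def, h1, Measure.restrict_apply (measurableSet_cell n j), h2, Real.volume_Ico,
    ENNReal.toReal_ofReal]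
  · ring
  · rw [← sub_div, add_sub_cancel_left]; positivity

noncomputable def vv (n : ℕ) (j : Fin n) : L2I :=
  indicatorConstLp 2 (measurableSet_cell n j) (measure_ne_top μ01 _) ((√(n:ℝ) : ℝ) : ℂ)

lemma vv_inner (n : ℕ) (j : Fin n) (f : L2I) :
    ⟪vv n j, f⟫_ℂ = ((√(n:ℝ) : ℝ) : ℂ) * ∫ y in cell n j, f y ∂μ01 := by
  rw [vv, L2.inner_indicatorConstLp_eq_inner_setIntegral]
  simp [mul_comm]

lemma vv_orthonormal (n : ℕ) : Orthonormal ℂ (vv n) := by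
  rw [orthonormal_iff_ite]
  intro i j
  have hn : (0:ℝ) < n := by exact_mod_cast (by have := i.2; omega : 0 < n)
  rw [vv, vv, L2.inner_indicatorConstLp_indicatorConstLp]
  split_ifs with h
  · subst h
    rw [inter_self, cell_measure n i i.2]
    have : (√(n:ℝ) : ℝ) * √(n:ℝ) = n := Real.mul_self_sqrt hn.le
    simp only [RCLike.inner_apply, Complex.conj_ofReal, ← Complex.ofReal_mul, this,
      Complex.real_smul]
    rw [one_div, inv_mul_cancel₀ hn.ne']; simp
  · have : cell n i ∩ cell n j = ∅ := by
      ext x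
      simp only [cell, mem_inter_iff, mem_ofPred_eq, mem_empty_iff_false, iff_false, not_and]
      intro h1 h2
      apply h
      ext
      rw [h1] at h2
      exact_mod_cast h2
    rw [this]; simp

noncomputable def Kn (γ : ℂ) (a : ℤ → ℂ) (n : ℕ) : L2I →L[ℂ] L2I :=
  ((n:ℂ) ^ (-γ - 1)) • (synth (vv n)).comp
    ((Matrix.toEuclideanCLM (𝕜 := ℂ) (n := Fin n) (toeplitz a n)).comp
      (ContinuousLinearMap.adjoint (synth (vv n))))

lemma norm_Kn (γ : ℂ) (a : ℤ → ℂ) (n : ℕ) (hn : 1 ≤ n) :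
    ‖Kn γ a n‖ = specNorm (toeplitz a n) / (n:ℝ) ^ (γ.re + 1) := by
  rw [Kn, norm_smul, norm_conj _ (vv_orthonormal n), Complex.norm_natCast_cpow_of_pos hn, specNorm]
  have : (-γ - 1).re = -(γ.re + 1) := by simp; ring
  rw [this, Real.rpow_neg (by positivity)]
  field_simp

lemma integrable_L2I (f : L2I) : Integrable f μ01 :=
  (Lp.memLp f).integrable (by norm_num)

lemma floor_mem (n : ℕ) (hn : 1 ≤ n) {x : ℝ} (hx : x ∈ Ioo (0:ℝ) 1) :
    ∃ j : Fin n, ⌊(n:ℝ) * x⌋ = ((j:ℕ) : ℤ) := by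
  have hn0 : (0:ℝ) < n := by exact_mod_cast hn
  have h0 : 0 ≤ ⌊(n:ℝ) * x⌋ := Int.floor_nonneg.2 (mul_nonneg hn0.le hx.1.le)
  have h1 : ⌊(n:ℝ) * x⌋ < n := by
    rw [Int.floor_lt]; push_cast; nlinarith [hx.2]
  exact ⟨⟨⌊(n:ℝ) * x⌋.toNat, by omega⟩, by simp [h0]⟩

lemma integrable_step (a : ℤ → ℂ) (n : ℕ) (hn : 1 ≤ n) (d : ℤ) (f : L2I) :
    Integrable (fun y => a (d - ⌊(n:ℝ) * y⌋) * f y) μ01 := by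
  have hm : Measurable fun y : ℝ => a (d - ⌊(n:ℝ) * y⌋) :=
    (measurable_from_top (f := fun e => a (d - e))).comp (Int.measurable_floor.comp (by fun_prop))
  refine (integrable_L2I f).bdd_mul (c := ∑ j : Fin n, ‖a (d - (j:ℕ))‖) hm.aestronglyMeasurable ?_
  filter_upwards [ae_restrict_mem measurableSet_Ioo] with y hy
  obtain ⟨j, hj⟩ := floor_mem n hn hy
  rw [hj]
  exact Finset.single_le_sum (f := fun j : Fin n => ‖a (d - (j:ℕ))‖) (fun _ _ => norm_nonneg _)
    (Finset.mem_univ j)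

lemma step_integral (a : ℤ → ℂ) (n : ℕ) (hn : 1 ≤ n) (d : ℤ) (f : L2I) :
    ∫ y, a (d - ⌊(n:ℝ) * y⌋) * f y ∂μ01 =
      ∑ k : Fin n, a (d - (k:ℕ)) * ∫ y in cell n k, f y ∂μ01 := by
  have : ∀ k : Fin n, a (d - (k:ℕ)) * ∫ y in cell n k, f y ∂μ01 =
      ∫ y, (cell n k).indicator (fun y => a (d - (k:ℕ)) * f y) y ∂μ01 := fun k => by
    rw [integral_indicator (measurableSet_cell n k), integral_const_mul]
  simp_rw [this]
  rw [← integral_finsetSum]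
  · refine integral_congr_ae ?_
    filter_upwards [ae_restrict_mem measurableSet_Ioo] with y hy
    obtain ⟨j, hj⟩ := floor_mem n hn hy
    rw [Finset.sum_eq_single j]
    · rw [indicator_of_mem (by exact hj), hj]
    · intro i _ hi
      refine indicator_of_notMem (fun h => hi ?_) _
      have h' : ⌊(n:ℝ) * y⌋ = ((i:ℕ) : ℤ) := h
      rw [hj] at h'
      ext; exact_mod_cast h'.symm
    · simp
  · intro k _
    exact ((integrable_L2I f).const_mul _).indicator (measurableSet_cell n k)

lemma coeFn_sum_L2I {ι : Type} (s : Finset ι) (g : ι → L2I) :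
    ∀ᵐ x ∂μ01, (∑ j ∈ s, g j : L2I) x = ∑ j ∈ s, g j x := by
  classical
  induction s using Finset.induction_on with
  | empty =>
    filter_upwards [Lp.coeFn_zero ℂ 2 μ01] with x hx
    simpa using hx
  | insert i s hi ih =>
    rw [Finset.sum_insert hi]
    filter_upwards [ih, Lp.coeFn_add (g i) (∑ j ∈ s, g j)] with x h1 h2
    rw [h2, Pi.add_apply, h1, Finset.sum_insert hi]

lemma Kn_apply (γ : ℂ) (a : ℤ → ℂ) (n : ℕ) (hn : 1 ≤ n) (f : L2I) :
    ∀ᵐ x ∂μ01, (Kn γ a n f : ℝ → ℂ) x =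
      ∫ y, ((n:ℂ) ^ (-γ) * a (⌊(n:ℝ) * x⌋ - ⌊(n:ℝ) * y⌋)) * f y ∂μ01 := by
  have hn0 : (0:ℝ) < n := by exact_mod_cast hn
  have hnc : (n:ℂ) ≠ 0 := by exact_mod_cast hn0.ne'
  set w : EuclideanSpace ℂ (Fin n) := Matrix.toEuclideanCLM (𝕜 := ℂ) (n := Fin n) (toeplitz a n)
    (ContinuousLinearMap.adjoint (synth (vv n)) f) with hw
  have e1 : Kn γ a n f = (n:ℂ) ^ (-γ - 1) • ∑ j, w j • vv n j := rfl
  have hwj : ∀ j, w j = ((√(n:ℝ) : ℝ) : ℂ) * ∑ k : Fin n, a ((j:ℕ) - (k:ℕ)) *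
      ∫ y in cell n k, f y ∂μ01 := fun j => by
    have : w j = ∑ k, toeplitz a n j k * (ContinuousLinearMap.adjoint (synth (vv n)) f) k := rfl
    rw [this, Finset.mul_sum]
    refine Finset.sum_congr rfl fun k _ => ?_
    rw [synth_adjoint_apply, vv_inner]
    simp only [toeplitz, Matrix.of_apply]
    ring
  have hv : ∀ᵐ x ∂μ01, ∀ j : Fin n, vv n j x =
      (cell n j).indicator (fun _ => ((√(n:ℝ) : ℝ) : ℂ)) x :=
    ae_all_iff.2 fun j => indicatorConstLp_coeFn
  have hs : ∀ᵐ x ∂μ01, ∀ j : Fin n, (w j • vv n j : L2I) x = w j * vv n j x :=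
    ae_all_iff.2 fun j => by
      filter_upwards [Lp.coeFn_smul (w j) (vv n j)] with x hx
      rw [hx]; rfl
  have hsum : ∀ᵐ x ∂μ01, (∑ j, w j • vv n j : L2I) x = ∑ j, (w j • vv n j : L2I) x := by
    exact coeFn_sum_L2I _ _
  rw [e1]
  filter_upwards [hv, hs, hsum, Lp.coeFn_smul ((n:ℂ) ^ (-γ - 1)) (∑ j, w j • vv n j),
    ae_restrict_mem measurableSet_Ioo] with x h1 h2 h3 h4 h5
  obtain ⟨j, hj⟩ := floor_mem n hn h5
  rw [h4, Pi.smul_apply, h3, Finset.sum_eq_single j]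
  · rw [h2, h1, indicator_of_mem (by exact hj), hj, hwj]
    simp_rw [mul_assoc]
    rw [integral_const_mul, step_integral a n hn]
    have hsq : ((√(n:ℝ) : ℝ) : ℂ) * ((√(n:ℝ) : ℝ) : ℂ) = n := by
      rw [← Complex.ofReal_mul, Real.mul_self_sqrt hn0.le]; simp
    have hp : (n:ℂ) ^ (-γ - 1) * n = (n:ℂ) ^ (-γ) := by
      rw [Complex.cpow_sub _ _ hnc, Complex.cpow_one]; field_simp
    rw [smul_eq_mul, ← hp, ← hsq]
    ring
  · intro i _ hi
    rw [h2, h1, indicator_of_notMem, mul_zero]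
    intro h
    have h' : ⌊(n:ℝ) * x⌋ = ((i:ℕ) : ℤ) := h
    rw [hj] at h'
    exact hi (by ext; exact_mod_cast h'.symm)
  · simp

lemma norm_diff (Cp Cm γ : ℂ) (hγ : -1 < γ.re) (a : ℤ → ℂ) (K : L2I →L[ℂ] L2I)
    (hK : IsIntegralOp (fun x y => kerf Cp Cm γ (x - y)) K) (n : ℕ) (hn : 1 ≤ n)
    (hB : ∫⁻ t in Ioo (-1:ℝ) 1, Hn Cp Cm γ a n t ≠ ∞) :
    ‖Kn γ a n - K‖ ≤ (∫⁻ t in Ioo (-1:ℝ) 1, Hn Cp Cm γ a n t).toReal := by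
  refine ContinuousLinearMap.opNorm_le_bound _ ENNReal.toReal_nonneg fun f => ?_
  have key := schur (Hn Cp Cm γ a n) (measurable_Hn Cp Cm γ a n) f ((Kn γ a n - K) f) (by
    have hfin := ae_fin (fun t => ‖kerf Cp Cm γ t‖ₑ) (measurable_kerf Cp Cm γ).enorm
      (kerf_fin Cp Cm γ hγ) f
    filter_upwards [hfin, Kn_apply γ a n hn f, hK f, Lp.coeFn_sub (Kn γ a n f) (K f)]
      with x h1 h2 h3 h4
    have hi1 : Integrable (fun y => (n:ℂ) ^ (-γ) * a (⌊(n:ℝ) * x⌋ - ⌊(n:ℝ) * y⌋) * f y) μ01 := by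
      simp_rw [mul_assoc]
      exact (integrable_step a n hn _ f).const_mul _
    have hi2 : Integrable (fun y => kerf Cp Cm γ (x - y) * f y) μ01 := by
      constructor
      · have h1 := measurable_kerf Cp Cm γ
        have h2 := (Lp.stronglyMeasurable f).measurable
        exact Measurable.aestronglyMeasurable (by fun_prop)
      · simpa [HasFiniteIntegral, enorm_mul] using h1
    rw [sub_apply, h4, Pi.sub_apply, h2, h3, ← integral_sub hi1 hi2]
    refine (enorm_integral_le_lintegral_enorm _).trans (lintegral_mono fun y => ?_)
    rw [← sub_mul, enorm_mul]
    gcongr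
    exact diff_le_Hn Cp Cm γ a n x y)
  have := ENNReal.toReal_mono (ENNReal.mul_ne_top hB enorm_ne_top) key
  simpa [ENNReal.toReal_mul] using this

lemma kerf_half (Cp Cm γ : ℂ) (hC : Cp ≠ 0 ∨ Cm ≠ 0) :
    ∃ t₀ : ℝ, |t₀| = 1 / 2 ∧ kerf Cp Cm γ t₀ ≠ 0 ∧ ContinuousAt (kerf Cp Cm γ) t₀ := by
  have hc : ∀ C : ℂ, ContinuousAt (fun t : ℝ => C * (t : ℂ) ^ γ) (1 / 2) := fun C => by
    have h1 : ContinuousAt (fun z : ℂ => z ^ γ) (((1/2 : ℝ)) : ℂ) :=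
      continuousAt_cpow_const (by
        rw [Complex.mem_slitPlane_iff]; left; rw [Complex.ofReal_re]; norm_num)
    have h2 : ContinuousAt (fun t : ℝ => (t : ℂ) ^ γ) (1 / 2) :=
      ContinuousAt.comp (f := fun t : ℝ => (t:ℂ)) h1 Complex.continuous_ofReal.continuousAt
    exact continuousAt_const.mul h2
  have hne : (((1/2 : ℝ)) : ℂ) ^ γ ≠ 0 := by
    rw [Ne, Complex.cpow_eq_zero_iff]; simp
  rcases hC with h | h
  · refine ⟨1 / 2, by norm_num [abs_of_pos], ?_, ?_⟩
    · rw [kerf, if_pos (by norm_num)]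
      exact mul_ne_zero h hne
    · refine (hc Cp).congr ?_
      filter_upwards [lt_mem_nhds (show (0:ℝ) < 1 / 2 by norm_num)] with t ht
      rw [kerf, if_pos ht]
  · refine ⟨-(1 / 2), by norm_num [abs_of_pos], ?_, ?_⟩
    · rw [kerf, if_neg (by norm_num), if_pos (by norm_num), neg_neg]
      exact mul_ne_zero h hne
    · have h3 : ContinuousAt (fun t : ℝ => Cm * ((-t : ℝ) : ℂ) ^ γ) (-(1 / 2)) :=
        ContinuousAt.comp (f := fun t : ℝ => -t) (g := fun t : ℝ => Cm * (t : ℂ) ^ γ)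
          (by rw [neg_neg]; exact hc Cm) continuous_neg.continuousAt
      refine h3.congr ?_
      filter_upwards [gt_mem_nhds (show -(1 / 2) < (0:ℝ) by norm_num)] with t ht
      rw [kerf, if_neg ht.not_gt, if_pos ht]

lemma K_ne_zero (Cp Cm γ : ℂ) (hC : Cp ≠ 0 ∨ Cm ≠ 0) (K : L2I →L[ℂ] L2I)
    (hK : IsIntegralOp (fun x y => kerf Cp Cm γ (x - y)) K) : K ≠ 0 := by
  rintro rfl
  obtain ⟨t₀, ht, hc, hcont⟩ := kerf_half Cp Cm γ hC
  set c := kerf Cp Cm γ t₀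
  have hcp : 0 < ‖c‖ := norm_pos_iff.2 hc
  obtain ⟨δ', hδ', hδc⟩ := Metric.continuousAt_iff.1 hcont (‖c‖ / 2) (by positivity)
  obtain ⟨δ, hδ, hδ1, hδ2⟩ : ∃ δ : ℝ, 0 < δ ∧ δ ≤ 1 / 8 ∧ 2 * δ ≤ δ' :=
    ⟨min (1 / 8) (δ' / 2), by positivity, min_le_left _ _, by
      linarith [min_le_right (1 / 8) (δ' / 2)]⟩
  have hvol : ∀ s : ℝ, |s| ≤ 1 / 4 →
      μ01 (Ioo (1 / 2 + s - δ) (1 / 2 + s + δ)) = ENNReal.ofReal (2 * δ) := fun s hs => by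
    have hs' := abs_le.1 hs
    rw [Measure.restrict_apply measurableSet_Ioo, inter_eq_left.2, Real.volume_Ioo]
    · congr 1; ring
    · exact Ioo_subset_Ioo (by linarith) (by linarith)
  have ht4 : |t₀ / 2| ≤ 1 / 4 := by rw [abs_div, ht]; norm_num
  set S := Ioo (1 / 2 + -(t₀ / 2) - δ) (1 / 2 + -(t₀ / 2) + δ) with hS
  have hSv := hvol (-(t₀ / 2)) (by rwa [abs_neg])
  set f : L2I := indicatorConstLp 2 (measurableSet_Ioo (a := 1 / 2 + -(t₀ / 2) - δ)
    (b := 1 / 2 + -(t₀ / 2) + δ)) (measure_ne_top μ01 _) (1:ℂ)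
  have hf : ∀ᵐ y ∂μ01, f y = S.indicator (fun _ => (1:ℂ)) y := indicatorConstLp_coeFn
  have h0 : ∀ᵐ x ∂μ01, x ∉ Ioo (1 / 2 + t₀ / 2 - δ) (1 / 2 + t₀ / 2 + δ) := by
    filter_upwards [hK f, Lp.coeFn_zero ℂ 2 μ01] with x h1 h2 hx
    have e1 : ∫ y in S, kerf Cp Cm γ (x - y) ∂μ01 = 0 := by
      rw [← integral_indicator measurableSet_Ioo]
      have h3 : (((0 : L2I →L[ℂ] L2I) f : L2I) : ℝ → ℂ) x = 0 := h2
      rw [h3] at h1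
      rw [h1]
      refine integral_congr_ae ?_
      filter_upwards [hf] with y hy
      rw [hy]
      by_cases hyS : y ∈ S
      · rw [indicator_of_mem hyS, indicator_of_mem hyS, mul_one]
      · rw [indicator_of_notMem hyS, indicator_of_notMem hyS, mul_zero]
    have hb : ∀ y ∈ S, ‖kerf Cp Cm γ (x - y) - c‖ ≤ ‖c‖ / 2 := fun y hy => by
      have := @hδc (x - y) (by
        rw [Real.dist_eq, abs_lt]
        constructor <;> linarith [hx.1, hx.2, hy.1, hy.2])
      rw [dist_eq_norm] at this
      exact this.le
    have hm : Measurable fun y => kerf Cp Cm γ (x - y) - c := by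
      have := measurable_kerf Cp Cm γ
      fun_prop
    have hi : IntegrableOn (fun y => kerf Cp Cm γ (x - y) - c) S μ01 :=
      Measure.integrableOn_of_bounded (M := ‖c‖ / 2) (measure_ne_top _ _) hm.aestronglyMeasurable
        ((ae_restrict_mem measurableSet_Ioo).mono hb)
    have hic : IntegrableOn (fun _ => c) S μ01 := integrableOn_const (measure_ne_top _ _)
    have e2 : ∫ y in S, kerf Cp Cm γ (x - y) ∂μ01 =
        ∫ y in S, (kerf Cp Cm γ (x - y) - c) ∂μ01 + ∫ y in S, c ∂μ01 := by
      rw [← integral_add hi hic]; simp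
    have e3 : ‖∫ y in S, (kerf Cp Cm γ (x - y) - c) ∂μ01‖ ≤ ‖c‖ / 2 * μ01.real S :=
      norm_setIntegral_le_of_norm_le_const (measure_lt_top _ _) hb
    have hSr : μ01.real S = 2 * δ := by
      rw [measureReal_def, hSv, ENNReal.toReal_ofReal (by positivity)]
    rw [e1, setIntegral_const, hSr] at e2
    have e4 : ∫ y in S, (kerf Cp Cm γ (x - y) - c) ∂μ01 = -((2 * δ) • c) :=
      eq_neg_of_add_eq_zero_left e2.symm
    rw [e4, norm_neg, norm_smul, hSr, Real.norm_eq_abs, abs_of_pos (by positivity)] at e3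
    nlinarith [mul_pos hcp hδ]
  have h1 := hvol (t₀ / 2) ht4
  rw [ae_iff] at h0
  simp only [not_not] at h0
  have h2 : μ01 (Ioo (1 / 2 + t₀ / 2 - δ) (1 / 2 + t₀ / 2 + δ)) = 0 := h0
  rw [h1, ENNReal.ofReal_eq_zero] at h2
  linarith

theorem stmt6 (Cp Cm γ : ℂ) (hγ : -1 < γ.re) (hC : Cp ≠ 0 ∨ Cm ≠ 0) (a : ℤ → ℂ)
    (εp εm : ℕ → ℂ) (hεp : Tendsto εp atTop (nhds 0)) (hεm : Tendsto εm atTop (nhds 0))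
    (hap : ∀ m : ℕ, 1 ≤ m → a (m : ℤ) = Cp * (m : ℂ) ^ γ * (1 + εp m))
    (ham : ∀ m : ℕ, 1 ≤ m → a (-(m : ℤ)) = Cm * (m : ℂ) ^ γ * (1 + εm m))
    (K : L2I →L[ℂ] L2I)
    (hK : IsIntegralOp (fun x y =>
      if y < x then Cp * ((x - y : ℝ) : ℂ) ^ γ
      else if x < y then Cm * ((y - x : ℝ) : ℂ) ^ γ else 0) K) :
    Tendsto (fun n : ℕ => specNorm (toeplitz a n) / (‖K‖ * (n : ℝ) ^ (γ.re + 1)))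
      atTop (nhds 1) := by
  have hker : (fun x y : ℝ => if y < x then Cp * ((x - y : ℝ) : ℂ) ^ γ
      else if x < y then Cm * ((y - x : ℝ) : ℂ) ^ γ else 0) =
      fun x y => kerf Cp Cm γ (x - y) := by
    funext x y
    simp only [kerf, sub_pos, sub_neg, neg_sub]
  rw [hker] at hK
  have hK0 : 0 < ‖K‖ := norm_pos_iff.2 (K_ne_zero Cp Cm γ hC K hK)
  have hB := Hn_tendsto Cp Cm γ hγ a εp εm hεp hεm hap ham
  have hBr := (ENNReal.tendsto_toReal ENNReal.zero_ne_top).comp hB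
  have hKn : Tendsto (fun n => Kn γ a n) atTop (nhds K) := by
    rw [tendsto_iff_norm_sub_tendsto_zero]
    refine squeeze_zero' (Eventually.of_forall fun _ => norm_nonneg _) ?_ hBr
    filter_upwards [eventually_ge_atTop 1, hB.eventually_lt_const ENNReal.zero_lt_top] with n hn hfin
    exact norm_diff Cp Cm γ hγ a K hK n hn hfin.ne
  have h1 := hKn.norm.div_const ‖K‖
  rw [div_self hK0.ne'] at h1
  refine h1.congr' ?_
  filter_upwards [eventually_ge_atTop 1] with n hn
  rw [norm_Kn γ a n hn, div_div, mul_comm]
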